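/- arXiv:1909.05724 — 2 statements merged into one kernel-verified Lean document; each statement's English description precedes it below -/
import Mathlib

section
/- Let f : ℝ^d → ℝ be a proper, nonnegative C² function, and let α > 0, β > 0 and a ∈ ℝ be constants such that Δf − α|∇f|² + βf ≤ a and Δf ≤ a hold everywhere on ℝ^d. Then the volume of the sublevel set D_r = {x ∈ ℝ^d : 2√(f(x)) ≤ √(2β)·r} grows polynomially: for every r ≥ 1, Vol(D_r) ≤ C·r^{2αa/β}, where C = e^{αβ/2} · ∫_{ℝ^d} e^{−αf} dx (which is finite). -/
open MeasureTheory Real Gradient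

/-- The Laplacian of a function on Euclidean space, as the trace of the second derivative. -/
noncomputable def lap {d : ℕ} (f : EuclideanSpace ℝ (Fin d) → ℝ)
    (x : EuclideanSpace ℝ (Fin d)) : ℝ :=
  ∑ i : Fin d,
    iteratedFDeriv ℝ 2 f x ![EuclideanSpace.single i 1, EuclideanSpace.single i 1]


lemma aux_integrable {d : ℕ} {f : EuclideanSpace ℝ (Fin d) → ℝ}
    (hf0 : ∀ x, 0 ≤ f x)
    (hproper : ∀ K : Set ℝ, IsCompact K → IsCompact (f ⁻¹' K)) (M : ℝ)
    {g : EuclideanSpace ℝ (Fin d) → ℝ} (hg : Continuous g) (h0 : ∀ x, M < f x → g x = 0) :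
    Integrable g := by
  apply hg.integrable_of_hasCompactSupport
  apply HasCompactSupport.intro (hproper (Set.Icc 0 M) isCompact_Icc)
  intro x hx
  apply h0
  by_contra h
  exact hx ⟨hf0 x, not_lt.1 h⟩

lemma aux_lap {d : ℕ} (f : EuclideanSpace ℝ (Fin d) → ℝ) (x : EuclideanSpace ℝ (Fin d)) :
    lap f x = ∑ i : Fin d, fderiv ℝ (fderiv ℝ f) x (EuclideanSpace.single i 1)
      (EuclideanSpace.single i 1) := by
  simp [lap, iteratedFDeriv_two_apply]

lemma aux_grad {d : ℕ} (f : EuclideanSpace ℝ (Fin d) → ℝ) (x : EuclideanSpace ℝ (Fin d)) :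
    ‖∇ f x‖ ^ 2 = ∑ i : Fin d, (fderiv ℝ f x (EuclideanSpace.single i 1)) ^ 2 := by
  rw [EuclideanSpace.real_norm_sq_eq]
  refine Finset.sum_congr rfl fun i _ => ?_
  rw [← inner_gradient_left, EuclideanSpace.inner_single_right]
  simp

lemma aux_cont {d : ℕ} {f : EuclideanSpace ℝ (Fin d) → ℝ} (hf : ContDiff ℝ 2 f) :
    Continuous (lap f) ∧ Continuous (fun x => ‖∇ f x‖ ^ 2) := by
  have c1 : ContDiff ℝ 1 (fderiv ℝ f) := hf.fderiv_right (by norm_num)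
  have c2 : Continuous (fderiv ℝ (fderiv ℝ f)) := c1.continuous_fderiv (by norm_num)
  have c3 : Continuous (fderiv ℝ f) := c1.continuous
  constructor
  · rw [funext (aux_lap f)]
    fun_prop
  · rw [funext (aux_grad f)]
    fun_prop

lemma aux_deriv_zero {ψ : ℝ → ℝ} {M : ℝ} (hM : ∀ s, M ≤ s → ψ s = 0) (s : ℝ) (hs : M < s) :
    deriv ψ s = 0 := by
  have : ψ =ᶠ[nhds s] fun _ => (0 : ℝ) := by
    filter_upwards [Ioi_mem_nhds hs] with u hu using hM u (le_of_lt hu)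
  rw [this.deriv_eq]
  simp

lemma aux_green {d : ℕ} {f : EuclideanSpace ℝ (Fin d) → ℝ}
    (hf : ContDiff ℝ 2 f) (hf0 : ∀ x, 0 ≤ f x)
    (hproper : ∀ K : Set ℝ, IsCompact K → IsCompact (f ⁻¹' K)) (M : ℝ)
    {ψ : ℝ → ℝ} (hψ : ContDiff ℝ 1 ψ) (hM : ∀ s, M ≤ s → ψ s = 0) :
    ∫ x, (ψ (f x) * lap f x + deriv ψ (f x) * ‖∇ f x‖ ^ 2) = 0 := by
  have c0 : Continuous f := hf.continuous
  have c1 : ContDiff ℝ 1 (fderiv ℝ f) := hf.fderiv_right (by norm_num)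
  have c2 : Continuous (fderiv ℝ (fderiv ℝ f)) := c1.continuous_fderiv (by norm_num)
  have c3 : Continuous (fderiv ℝ f) := c1.continuous
  have c4 : Continuous ψ := hψ.continuous
  have c5 : Continuous (deriv ψ) := hψ.continuous_deriv (by norm_num)
  have hz := aux_deriv_zero hM
  set e : Fin d → EuclideanSpace ℝ (Fin d) := fun i => EuclideanSpace.single i 1 with he
  have i1 : ∀ i, Integrable (fun x => ψ (f x) * fderiv ℝ (fderiv ℝ f) x (e i) (e i)) := fun i =>
    aux_integrable hf0 hproper M (by fun_prop) (fun x hx => by simp [hM _ hx.le])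
  have i2 : ∀ i, Integrable (fun x => deriv ψ (f x) * (fderiv ℝ f x (e i)) ^ 2) := fun i =>
    aux_integrable hf0 hproper M (by fun_prop) (fun x hx => by simp [hz _ hx])
  have i3 : ∀ i, Integrable (fun x => ψ (f x) * fderiv ℝ f x (e i)) := fun i =>
    aux_integrable hf0 hproper M (by fun_prop) (fun x hx => by simp [hM _ hx.le])
  have d1 : ∀ i x, fderiv ℝ (fun x => fderiv ℝ f x (e i)) x (e i)
      = fderiv ℝ (fderiv ℝ f) x (e i) (e i) := by
    intro i x
    have := ((c1.differentiable (by norm_num) x).hasFDerivAt.clm_apply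
      (hasFDerivAt_const (e i) x)).fderiv
    rw [this]
    simp
  have d2 : ∀ i x, fderiv ℝ (fun x => ψ (f x)) x (e i)
      = deriv ψ (f x) * fderiv ℝ f x (e i) := by
    intro i x
    have := ((hψ.differentiable (by norm_num) (f x)).hasDerivAt.comp_hasFDerivAt x
      (hf.differentiable (by norm_num) x).hasFDerivAt).fderiv
    rw [Function.comp_def] at this
    rw [this]
    simp
  have key : ∀ i, ∫ x, ψ (f x) * fderiv ℝ (fderiv ℝ f) x (e i) (e i)
      = - ∫ x, deriv ψ (f x) * (fderiv ℝ f x (e i)) ^ 2 := by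
    intro i
    have := integral_mul_fderiv_eq_neg_fderiv_mul_of_integrable (μ := volume) (v := e i)
      (f := fun x => ψ (f x)) (g := fun x => fderiv ℝ f x (e i)) ?_ ?_ (i3 i) ?_ ?_
    · simp only [d1, d2] at this
      rw [this]
      congr 2
      ext x
      ring
    · simp only [d2]
      refine (i2 i).congr (Filter.Eventually.of_forall fun x => ?_)
      simp only
      ring
    · simp only [d1]
      exact i1 i
    · intro x _
      exact (hψ.differentiable (by norm_num) (f x)).comp x (hf.differentiable (by norm_num) x)
    · intro x _
      exact (c1.differentiable (by norm_num) x).clm_apply (differentiableAt_const _)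
  simp only [aux_lap, aux_grad, Finset.mul_sum]
  rw [integral_add (integrable_finsetSum _ fun i _ => i1 i)
    (integrable_finsetSum _ fun i _ => i2 i),
    integral_finsetSum _ fun i _ => i1 i, integral_finsetSum _ fun i _ => i2 i,
    ← Finset.sum_add_distrib]
  refine Finset.sum_eq_zero fun i _ => ?_
  rw [key i]
  ring

lemma aux_ineq {d : ℕ} {f : EuclideanSpace ℝ (Fin d) → ℝ}
    (hf : ContDiff ℝ 2 f) (hf0 : ∀ x, 0 ≤ f x)
    (hproper : ∀ K : Set ℝ, IsCompact K → IsCompact (f ⁻¹' K))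
    {α β a : ℝ}
    (h1 : ∀ x, lap f x - α * ‖∇ f x‖ ^ 2 + β * f x ≤ a)
    (h2 : ∀ x, lap f x ≤ a) (M s : ℝ) (hs0 : 0 ≤ s) (hs1 : s ≤ 1) :
    0 ≤ ∫ x, smoothTransition (M - f x) * exp (-α * s * f x) * (a - β * s * f x) := by
  set ψ : ℝ → ℝ := fun u => smoothTransition (M - u) * exp (-α * s * u) with hψd
  have ct : ContDiff ℝ 1 smoothTransition := smoothTransition.contDiff (n := 1)
  have hψ : ContDiff ℝ 1 ψ := by
    apply ContDiff.mul
    · exact ct.comp (contDiff_const.sub contDiff_id)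
    · exact (contDiff_const.mul contDiff_id).exp
  have hM : ∀ u, M ≤ u → ψ u = 0 := fun u hu => by
    simp [hψd, smoothTransition.zero_of_nonpos (sub_nonpos.2 hu)]
  have hψ0 : ∀ u, 0 ≤ ψ u := fun u => mul_nonneg (smoothTransition.nonneg _) (exp_pos _).le
  have hd : ∀ u, deriv ψ u ≤ -α * s * ψ u := by
    intro u
    have e1 : HasDerivAt (fun u => smoothTransition (M - u))
        (deriv smoothTransition (M - u) * (-1)) u := by
      have := (ct.differentiable (by norm_num) (M - u)).hasDerivAt.comp u
        ((hasDerivAt_id u).const_sub M)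
      simpa [Function.comp_def] using this
    have e2 : HasDerivAt (fun u => exp (-α * s * u)) (exp (-α * s * u) * (-α * s)) u := by
      simpa using ((hasDerivAt_id u).const_mul (-α * s)).exp
    have e3 : deriv ψ u = _ := (e1.mul e2).deriv
    rw [e3]
    have : 0 ≤ deriv smoothTransition (M - u) := smoothTransition.monotone.deriv_nonneg
    have := mul_nonneg this (exp_pos (-α * s * u)).le
    simp only [hψd]
    linarith
  have c0 : Continuous f := hf.continuous
  have c4 : Continuous ψ := hψ.continuous
  have c5 : Continuous (deriv ψ) := hψ.continuous_deriv (by norm_num)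
  obtain ⟨c6, c7⟩ := aux_cont hf
  have hz := aux_deriv_zero hM
  rw [← aux_green hf hf0 hproper M hψ hM]
  apply integral_mono
  · exact aux_integrable hf0 hproper M (by fun_prop) (fun x hx => by simp [hM _ hx.le, hz _ hx])
  · exact aux_integrable hf0 hproper M (g := fun x => ψ (f x) * (a - β * s * f x)) (by fun_prop)
      (fun x hx => by simp [hM _ hx.le])
  · intro x
    change ψ (f x) * lap f x + deriv ψ (f x) * ‖∇ f x‖ ^ 2 ≤ ψ (f x) * (a - β * s * f x)
    have a1 := mul_le_mul_of_nonneg_right (hd (f x)) (sq_nonneg ‖∇ f x‖)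
    have a2 : lap f x - s * α * ‖∇ f x‖ ^ 2 ≤ a - β * s * f x := by
      have := mul_le_mul_of_nonneg_left (h1 x) hs0
      have := mul_le_mul_of_nonneg_left (h2 x) (sub_nonneg.2 hs1)
      linarith
    have a3 := mul_le_mul_of_nonneg_left a2 (hψ0 (f x))
    linarith

lemma aux_mono {d : ℕ} {f : EuclideanSpace ℝ (Fin d) → ℝ}
    (hf : ContDiff ℝ 2 f) (hf0 : ∀ x, 0 ≤ f x)
    (hproper : ∀ K : Set ℝ, IsCompact K → IsCompact (f ⁻¹' K))
    {α β a : ℝ} (hα : 0 < α) (hβ : 0 < β)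
    (h1 : ∀ x, lap f x - α * ‖∇ f x‖ ^ 2 + β * f x ≤ a)
    (h2 : ∀ x, lap f x ≤ a) (M s : ℝ) (hs0 : 0 < s) (hs1 : s ≤ 1) :
    s ^ (α * a / β) * ∫ x, smoothTransition (M - f x) * exp (-α * s * f x) ≤
      ∫ x, smoothTransition (M - f x) * exp (-α * 1 * f x) := by
  have c0 : Continuous f := hf.continuous
  have ct : Continuous smoothTransition := smoothTransition.continuous
  have hz : ∀ x, M < f x → smoothTransition (M - f x) = 0 := fun x hx =>
    smoothTransition.zero_of_nonpos (by linarith)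
  set K : ℝ → ℝ := fun s => ∫ x, smoothTransition (M - f x) * exp (-α * s * f x) with hK
  have iF : ∀ s, Integrable (fun x => smoothTransition (M - f x) * exp (-α * s * f x)) := fun s =>
    aux_integrable hf0 hproper M (by fun_prop) (fun x hx => by simp [hz x hx])
  have iF' : ∀ s, Integrable
      (fun x => smoothTransition (M - f x) * (exp (-α * s * f x) * (-α * f x))) := fun s =>
    aux_integrable hf0 hproper M (by fun_prop) (fun x hx => by simp [hz x hx])
  have hder : ∀ s, 0 < s → HasDerivAt K
      (∫ x, smoothTransition (M - f x) * (exp (-α * s * f x) * (-α * f x))) s := by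
    intro s hs
    refine (hasDerivAt_integral_of_dominated_loc_of_deriv_le (s := Set.Ioi 0)
      (bound := fun x => smoothTransition (M - f x) * (α * f x))
      (F' := fun s x => smoothTransition (M - f x) * (exp (-α * s * f x) * (-α * f x)))
      (Ioi_mem_nhds hs)
      (Filter.Eventually.of_forall fun s => (iF s).aestronglyMeasurable) (iF s)
      (iF' s).aestronglyMeasurable ?_ ?_ ?_).2
    · refine Filter.Eventually.of_forall fun x t ht => ?_
      have ht : 0 < t := ht
      have p0 : 0 ≤ α * f x := mul_nonneg hα.le (hf0 x)
      rw [norm_mul, norm_mul, Real.norm_of_nonneg (smoothTransition.nonneg _),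
        Real.norm_of_nonneg (exp_pos _).le, neg_mul α (f x), norm_neg, Real.norm_of_nonneg p0]
      refine mul_le_mul_of_nonneg_left ?_ (smoothTransition.nonneg _)
      refine mul_le_of_le_one_left p0 (exp_le_one_iff.2 ?_)
      nlinarith
    · exact aux_integrable hf0 hproper M (by fun_prop) (fun x hx => by simp [hz x hx])
    · refine Filter.Eventually.of_forall fun x t _ => ?_
      have : HasDerivAt (fun t : ℝ => -α * t * f x) (-α * f x) t := by
        simpa using ((hasDerivAt_id t).const_mul (-α)).mul_const (f x)
      exact this.exp.const_mul _
  have hmono : MonotoneOn (fun s => s ^ (α * a / β) * K s) (Set.Ioc 0 1) := by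
    have hd : ∀ s, 0 < s → HasDerivAt (fun s => s ^ (α * a / β) * K s)
        ((α * a / β) * s ^ (α * a / β - 1) * K s + s ^ (α * a / β) *
          (∫ x, smoothTransition (M - f x) * (exp (-α * s * f x) * (-α * f x)))) s := fun s hs =>
      (Real.hasDerivAt_rpow_const (Or.inl hs.ne')).mul (hder s hs)
    apply monotoneOn_of_deriv_nonneg (convex_Ioc 0 1)
    · exact fun s hs => (hd s hs.1).continuousAt.continuousWithinAt
    · intro s hs
      rw [interior_Ioc] at hs
      exact (hd s hs.1).differentiableAt.differentiableWithinAt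
    · intro s hs
      rw [interior_Ioc] at hs
      obtain ⟨p, q⟩ := hs
      rw [(hd s p).deriv]
      have h := aux_ineq hf hf0 hproper h1 h2 M s p.le q.le
      have e : ∫ x, smoothTransition (M - f x) * exp (-α * s * f x) * (a - β * s * f x)
          = a * K s + (β * s / α) *
          (∫ x, smoothTransition (M - f x) * (exp (-α * s * f x) * (-α * f x))) := by
        rw [hK, ← integral_const_mul, ← integral_const_mul,
          ← integral_add ((iF s).const_mul _) ((iF' s).const_mul _)]
        congr 1
        ext x
        field_simp
        ring
      rw [e] at h
      rw [Real.rpow_sub_one p.ne']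
      have : 0 ≤ (α / (β * s) * s ^ (α * a / β)) * (a * K s + (β * s / α) *
          (∫ x, smoothTransition (M - f x) * (exp (-α * s * f x) * (-α * f x)))) :=
        mul_nonneg (by positivity) h
      convert this using 1
      field_simp
  have := hmono ⟨hs0, hs1⟩ ⟨one_pos, le_rfl⟩ hs1
  simpa [hK] using this

lemma aux_finite {d : ℕ} {f : EuclideanSpace ℝ (Fin d) → ℝ}
    (hf : ContDiff ℝ 2 f) (hf0 : ∀ x, 0 ≤ f x)
    (hproper : ∀ K : Set ℝ, IsCompact K → IsCompact (f ⁻¹' K))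
    {α β a : ℝ} (hα : 0 < α) (hβ : 0 < β)
    (h1 : ∀ x, lap f x - α * ‖∇ f x‖ ^ 2 + β * f x ≤ a)
    (h2 : ∀ x, lap f x ≤ a) :
    (∫⁻ x : EuclideanSpace ℝ (Fin d), ENNReal.ofReal (Real.exp (-α * f x))) < ⊤ := by
  have c0 : Continuous f := hf.continuous
  have ct : Continuous smoothTransition := smoothTransition.continuous
  -- the dominating compactly supported function
  set G : EuclideanSpace ℝ (Fin d) → ℝ := fun x => max 0 (a + 1 - β * f x) with hG
  have iG : Integrable G := aux_integrable hf0 hproper ((a + 1) / β) (by fun_prop) (fun x hx => by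
    rw [div_lt_iff₀ hβ] at hx
    simp only [hG]
    apply max_eq_left
    linarith)
  have bd : ∀ M, ∫ x, smoothTransition (M - f x) * exp (-α * f x) ≤ ∫ x, G x := by
    intro M
    have hz : ∀ x, M < f x → smoothTransition (M - f x) = 0 := fun x hx =>
      smoothTransition.zero_of_nonpos (by linarith)
    have h := aux_ineq hf hf0 hproper h1 h2 M 1 zero_le_one le_rfl
    simp only [mul_one] at h
    have iA : Integrable (fun x => smoothTransition (M - f x) * exp (-α * f x)) :=
      aux_integrable hf0 hproper M (by fun_prop) (fun x hx => by simp [hz x hx])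
    have iB : Integrable (fun x => smoothTransition (M - f x) * exp (-α * f x) * (a - β * f x)) :=
      aux_integrable hf0 hproper M (by fun_prop) (fun x hx => by simp [hz x hx])
    calc ∫ x, smoothTransition (M - f x) * exp (-α * f x)
        ≤ (∫ x, smoothTransition (M - f x) * exp (-α * f x)) +
          ∫ x, smoothTransition (M - f x) * exp (-α * f x) * (a - β * f x) := by linarith
      _ = ∫ x, (smoothTransition (M - f x) * exp (-α * f x) +
          smoothTransition (M - f x) * exp (-α * f x) * (a - β * f x)) := (integral_add iA iB).symm
      _ ≤ ∫ x, G x := by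
        refine integral_mono (iA.add iB) iG fun x => ?_
        have p0 : 0 ≤ smoothTransition (M - f x) * exp (-α * f x) :=
          mul_nonneg (smoothTransition.nonneg _) (exp_pos _).le
        have p1 : smoothTransition (M - f x) * exp (-α * f x) ≤ 1 :=
          mul_le_one₀ (smoothTransition.le_one _) (exp_pos _).le
            (exp_le_one_iff.2 (by nlinarith [mul_nonneg hα.le (hf0 x)]))
        have g0 : 0 ≤ G x := le_max_left _ _
        have g1 : a + 1 - β * f x ≤ G x := le_max_right _ _
        calc _ = smoothTransition (M - f x) * exp (-α * f x) * (a + 1 - β * f x) := by ring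
          _ ≤ smoothTransition (M - f x) * exp (-α * f x) * G x :=
            mul_le_mul_of_nonneg_left g1 p0
          _ ≤ G x := mul_le_of_le_one_left g0 p1
  have hU : (⋃ n : ℕ, {x | f x ≤ n}) = Set.univ := by
    ext x
    simpa using exists_nat_ge (f x)
  have hdir : Directed (· ⊆ ·) (fun n : ℕ => {x | f x ≤ n}) := by
    apply Monotone.directed_le
    intro m n hmn x hx
    have : (m : ℝ) ≤ n := by exact_mod_cast hmn
    exact le_trans (show f x ≤ m from hx) this
  rw [← setLIntegral_univ, ← hU, setLIntegral_iUnion_of_directed _ hdir]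
  refine lt_of_le_of_lt (iSup_le fun n => ?_) (ENNReal.ofReal_lt_top (r := ∫ x, G x))
  refine le_trans ?_ (ENNReal.ofReal_le_ofReal (bd (n + 1)))
  have hz : ∀ x, (n + 1 : ℝ) < f x → smoothTransition (n + 1 - f x) = 0 := fun x hx =>
      smoothTransition.zero_of_nonpos (by linarith)
  rw [ofReal_integral_eq_lintegral_ofReal]
  · refine le_trans (setLIntegral_mono' (c0.measurable measurableSet_Iic)
      (g := fun x => ENNReal.ofReal (smoothTransition (n + 1 - f x) * exp (-α * f x)))
      fun x hx => ?_) (setLIntegral_le_lintegral _ _)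
    have hx : f x ≤ n := hx
    rw [smoothTransition.one_of_one_le (by linarith), one_mul]
  · exact aux_integrable hf0 hproper (n + 1) (by fun_prop) (fun x hx => by simp [hz x hx])
  · exact Filter.Eventually.of_forall fun x =>
      mul_nonneg (smoothTransition.nonneg _) (exp_pos _).le

theorem volume_sublevel_polynomial_growth {d : ℕ} (f : EuclideanSpace ℝ (Fin d) → ℝ)
    (hf : ContDiff ℝ 2 f) (hf0 : ∀ x, 0 ≤ f x)
    (hproper : ∀ K : Set ℝ, IsCompact K → IsCompact (f ⁻¹' K))
    (α β a : ℝ) (hα : 0 < α) (hβ : 0 < β)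
    (h1 : ∀ x, lap f x - α * ‖∇ f x‖ ^ 2 + β * f x ≤ a)
    (h2 : ∀ x, lap f x ≤ a) :
    (∫⁻ x : EuclideanSpace ℝ (Fin d), ENNReal.ofReal (Real.exp (-α * f x))) < ⊤ ∧
      ∀ r : ℝ, 1 ≤ r →
        volume {x : EuclideanSpace ℝ (Fin d) | 2 * Real.sqrt (f x) ≤ Real.sqrt (2 * β) * r} ≤
          (ENNReal.ofReal (Real.exp (α * β / 2)) *
              ∫⁻ x : EuclideanSpace ℝ (Fin d), ENNReal.ofReal (Real.exp (-α * f x))) *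
            ENNReal.ofReal (r ^ (2 * α * a / β)) := by
  have c0 : Continuous f := hf.continuous
  have ct : Continuous smoothTransition := smoothTransition.continuous
  have hfin := aux_finite hf hf0 hproper hα hβ h1 h2
  refine ⟨hfin, fun r hr => ?_⟩
  have r0 : 0 < r := by linarith
  set R : ℝ := β * r ^ 2 / 2 with hR
  set s : ℝ := (r ^ 2)⁻¹ with hs
  have s0 : 0 < s := by positivity
  have s1 : s ≤ 1 := inv_le_one_of_one_le₀ (by nlinarith)
  have hsub : {x | 2 * √(f x) ≤ √(2 * β) * r} ⊆ {x | f x ≤ R} := by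
    intro x hx
    have hx : 2 * √(f x) ≤ √(2 * β) * r := hx
    have := pow_le_pow_left₀ (by positivity) hx 2
    rw [mul_pow, mul_pow, Real.sq_sqrt (hf0 x), Real.sq_sqrt (by positivity)] at this
    simp only [Set.mem_ofPred_eq, hR]
    linarith
  have hz : ∀ x, R + 1 < f x → smoothTransition (R + 1 - f x) = 0 := fun x hx =>
    smoothTransition.zero_of_nonpos (by linarith)
  have iF : ∀ s, Integrable (fun x => smoothTransition (R + 1 - f x) * exp (-α * s * f x)) :=
    fun s => aux_integrable hf0 hproper (R + 1) (by fun_prop) (fun x hx => by simp [hz x hx])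
  have nF : ∀ s x, 0 ≤ smoothTransition (R + 1 - f x) * exp (-α * s * f x) := fun s x =>
    mul_nonneg (smoothTransition.nonneg _) (exp_pos _).le
  have hm := aux_mono hf hf0 hproper hα hβ h1 h2 (R + 1) s s0 s1
  set c := α * a / β with hc
  have hsc : s ^ c * r ^ (2 * α * a / β) = 1 := by
    rw [hs, Real.inv_rpow (by positivity), ← Real.rpow_natCast r 2, ← Real.rpow_mul r0.le]
    have : ((2 : ℕ) : ℝ) * c = 2 * α * a / β := by rw [hc]; push_cast; ring
    rw [this]
    exact inv_mul_cancel₀ (Real.rpow_pos_of_pos r0 _).ne'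
  have hrp : 0 < r ^ (2 * α * a / β) := Real.rpow_pos_of_pos r0 _
  have hm2 : ∫ x, smoothTransition (R + 1 - f x) * exp (-α * s * f x) ≤
      (∫ x, smoothTransition (R + 1 - f x) * exp (-α * 1 * f x)) * r ^ (2 * α * a / β) := by
    have := mul_le_mul_of_nonneg_right hm hrp.le
    calc _ = (s ^ c * r ^ (2 * α * a / β)) *
          ∫ x, smoothTransition (R + 1 - f x) * exp (-α * s * f x) := by rw [hsc, one_mul]
      _ ≤ _ := by linarith
  have hsR : α * s * R = α * β / 2 := by
    rw [hs, hR]; field_simp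
  calc volume {x | 2 * √(f x) ≤ √(2 * β) * r} ≤ volume {x | f x ≤ R} := measure_mono hsub
    _ = ∫⁻ x in {x | f x ≤ R}, 1 := by simp
    _ ≤ ∫⁻ x in {x | f x ≤ R}, ENNReal.ofReal (exp (α * β / 2)) *
        ENNReal.ofReal (smoothTransition (R + 1 - f x) * exp (-α * s * f x)) := by
      refine setLIntegral_mono' (c0.measurable measurableSet_Iic) fun x hx => ?_
      have hx : f x ≤ R := hx
      rw [← ENNReal.ofReal_mul (exp_pos _).le, smoothTransition.one_of_one_le (by linarith),
        one_mul, ← exp_add]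
      apply ENNReal.one_le_ofReal.2
      apply Real.one_le_exp
      have := mul_le_mul_of_nonneg_left hx (mul_pos hα s0).le
      linarith
    _ ≤ ∫⁻ x, ENNReal.ofReal (exp (α * β / 2)) *
        ENNReal.ofReal (smoothTransition (R + 1 - f x) * exp (-α * s * f x)) :=
      setLIntegral_le_lintegral _ _
    _ = ENNReal.ofReal (exp (α * β / 2)) *
        ENNReal.ofReal (∫ x, smoothTransition (R + 1 - f x) * exp (-α * s * f x)) := by
      rw [lintegral_const_mul' _ _ ENNReal.ofReal_ne_top,
        ofReal_integral_eq_lintegral_ofReal (iF s) (Filter.Eventually.of_forall (nF s))]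
    _ ≤ ENNReal.ofReal (exp (α * β / 2)) *
        (ENNReal.ofReal (∫ x, smoothTransition (R + 1 - f x) * exp (-α * 1 * f x)) *
          ENNReal.ofReal (r ^ (2 * α * a / β))) := by
      rw [← ENNReal.ofReal_mul (integral_nonneg (nF 1))]
      gcongr
    _ ≤ _ := by
      rw [← mul_assoc]
      gcongr
      rw [ofReal_integral_eq_lintegral_ofReal (iF 1) (Filter.Eventually.of_forall (nF 1))]
      refine lintegral_mono fun x => ENNReal.ofReal_le_ofReal ?_
      rw [mul_one]
      exact mul_le_of_le_one_left (exp_pos _).le (smoothTransition.le_one _)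
end

section
/- Let f : ℝ^d → ℝ be a proper, nonnegative C² function, and let α > 0, β > 0 and a ∈ ℝ be constants such that Δf − α|∇f|² + βf ≤ a and Δf ≤ a hold everywhere on ℝ^d. Then for every r ≥ 1, ∫_{D_r} e^{−αf} dx − ∫_{D_{r−1}} e^{−αf} dx ≤ e^{αβ/2} · r^{2αa/β} · e^{−αβ(r−1)²/2} · ∫_{D_r} e^{−αf} dx, where D_r = {x ∈ ℝ^d : 2√(f(x)) ≤ √(2β)·r}. -/
open MeasureTheory Real Gradient

lemma sum_fderiv_sq {d : ℕ} (f : EuclideanSpace ℝ (Fin d) → ℝ) (x : EuclideanSpace ℝ (Fin d)) :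
    ∑ i : Fin d, fderiv ℝ f x (EuclideanSpace.single i 1) * fderiv ℝ f x (EuclideanSpace.single i 1)
      = ‖∇ f x‖ ^ 2 := by
  rw [EuclideanSpace.real_norm_sq_eq]
  refine Finset.sum_congr rfl fun i _ => ?_
  rw [← inner_gradient_left, EuclideanSpace.inner_single_right]
  simp [sq]

lemma continuous_lap {d : ℕ} (f : EuclideanSpace ℝ (Fin d) → ℝ) (hf : ContDiff ℝ 2 f) :
    Continuous (lap f) := by
  unfold lap
  refine continuous_finsetSum _ fun i _ => ?_
  have := hf.continuous_iteratedFDeriv (m := 2) le_rfl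
  fun_prop

lemma continuous_grad {d : ℕ} (f : EuclideanSpace ℝ (Fin d) → ℝ) (hf : ContDiff ℝ 2 f) :
    Continuous (fun x => ‖∇ f x‖ ^ 2) := by
  have h1 : Continuous (fderiv ℝ f) := hf.continuous_fderiv (by norm_num)
  have : (fun x => ‖∇ f x‖ ^ 2) = fun x => ‖fderiv ℝ f x‖ ^ 2 := by
    ext x
    simp [gradient]
  rw [this]
  fun_prop

/-- compositions with functions vanishing above `R`, times continuous, are integrable -/
lemma integrable_comp_mul {d : ℕ} (f : EuclideanSpace ℝ (Fin d) → ℝ)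
    (hf : Continuous f) (hf0 : ∀ x, 0 ≤ f x)
    (hproper : ∀ K : Set ℝ, IsCompact K → IsCompact (f ⁻¹' K))
    (g : ℝ → ℝ) (hg : Continuous g) (R : ℝ) (hR : ∀ s, R ≤ s → g s = 0)
    (u : EuclideanSpace ℝ (Fin d) → ℝ) (hu : Continuous u) :
    Integrable (fun x => g (f x) * u x) := by
  apply Continuous.integrable_of_hasCompactSupport (by fun_prop)
  refine HasCompactSupport.intro (hproper (Set.Icc 0 R) isCompact_Icc) fun x hx => ?_
  have : R ≤ f x := by
    by_contra h
    exact hx ⟨hf0 x, by linarith⟩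
  simp [hR _ this]

lemma ibp {d : ℕ} (f : EuclideanSpace ℝ (Fin d) → ℝ)
    (hf : ContDiff ℝ 2 f) (hf0 : ∀ x, 0 ≤ f x)
    (hproper : ∀ K : Set ℝ, IsCompact K → IsCompact (f ⁻¹' K))
    (g g' : ℝ → ℝ) (hg : ∀ s, HasDerivAt g (g' s) s) (hg' : Continuous g') (R : ℝ)
    (hR : ∀ s, R ≤ s → g s = 0) (hR' : ∀ s, R ≤ s → g' s = 0) :
    ∫ x, g (f x) * lap f x + g' (f x) * ‖∇ f x‖ ^ 2 = 0 := by
  have hgc : Continuous g := continuous_iff_continuousAt.2 fun s => (hg s).continuousAt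
  have hfc := hf.continuous
  have hfd : Differentiable ℝ f := hf.differentiable (by norm_num)
  have h1 : ContDiff ℝ 1 (fderiv ℝ f) := hf.fderiv_right (by norm_num)
  have h1c := h1.continuous
  have h1d : Differentiable ℝ (fderiv ℝ f) := h1.differentiable (by norm_num)
  have h2c : Continuous (fderiv ℝ (fderiv ℝ f)) := h1.continuous_fderiv (by norm_num)
  have hgf : ∀ x, HasFDerivAt (fun y => g (f y)) (g' (f x) • fderiv ℝ f x) x := fun x =>
    (hg (f x)).comp_hasFDerivAt x (hfd x).hasFDerivAt
  have I1 : ∀ i : Fin d, Integrable (fun x => g (f x) *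
      fderiv ℝ (fderiv ℝ f) x (EuclideanSpace.single i 1) (EuclideanSpace.single i 1)) := fun i =>
    integrable_comp_mul f hfc hf0 hproper g hgc R hR _ (by fun_prop)
  have I2 : ∀ i : Fin d, Integrable (fun x => g' (f x) *
      (fderiv ℝ f x (EuclideanSpace.single i 1) * fderiv ℝ f x (EuclideanSpace.single i 1))) :=
    fun i => integrable_comp_mul f hfc hf0 hproper g' hg' R hR' _ (by fun_prop)
  have I3 : ∀ i : Fin d, Integrable (fun x => g (f x) *
      fderiv ℝ f x (EuclideanSpace.single i 1)) := fun i =>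
    integrable_comp_mul f hfc hf0 hproper g hgc R hR _ (by fun_prop)
  have key : ∀ i : Fin d, ∫ x, (g (f x) *
      fderiv ℝ (fderiv ℝ f) x (EuclideanSpace.single i 1) (EuclideanSpace.single i 1)
      + g' (f x) * (fderiv ℝ f x (EuclideanSpace.single i 1) *
        fderiv ℝ f x (EuclideanSpace.single i 1))) = 0 := by
    intro i
    rw [integral_add (I1 i) (I2 i)]
    set v : EuclideanSpace ℝ (Fin d) := EuclideanSpace.single i 1
    have e1 : ∀ x, fderiv ℝ (fun y => fderiv ℝ f y v) x v = fderiv ℝ (fderiv ℝ f) x v v := by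
      intro x
      have := ((h1d x).hasFDerivAt.clm_apply (hasFDerivAt_const v x)).fderiv
      rw [this]; simp
    have e2 : ∀ x, fderiv ℝ (fun y => g (f y)) x v = g' (f x) * fderiv ℝ f x v := by
      intro x
      rw [(hgf x).fderiv]; simp
    have := integral_mul_fderiv_eq_neg_fderiv_mul_of_integrable
      (f := fun y => g (f y)) (g := fun y => fderiv ℝ f y v) (v := v) (μ := volume)
      (by simp only [e2, mul_assoc]; exact I2 i) (by simp only [e1]; exact I1 i) (I3 i)
      (fun x _ => (hgf x).differentiableAt)
      (fun x _ => (h1d x).clm_apply (differentiableAt_const v))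
    simp only [e1, e2, mul_assoc] at this
    rw [this]; ring
  have : ∀ x, g (f x) * lap f x + g' (f x) * ‖∇ f x‖ ^ 2 = ∑ i : Fin d, (g (f x) *
      fderiv ℝ (fderiv ℝ f) x (EuclideanSpace.single i 1) (EuclideanSpace.single i 1)
      + g' (f x) * (fderiv ℝ f x (EuclideanSpace.single i 1) *
        fderiv ℝ f x (EuclideanSpace.single i 1))) := by
    intro x
    rw [Finset.sum_add_distrib, ← Finset.mul_sum, ← Finset.mul_sum, sum_fderiv_sq]
    simp [lap, iteratedFDeriv_two_apply]
  simp only [this]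
  rw [integral_finsetSum]
  swap
  · exact fun i _ => (I1 i).add (I2 i)
  exact Finset.sum_eq_zero fun i _ => key i

lemma core {d : ℕ} (f : EuclideanSpace ℝ (Fin d) → ℝ)
    (hf : ContDiff ℝ 2 f) (hf0 : ∀ x, 0 ≤ f x)
    (hproper : ∀ K : Set ℝ, IsCompact K → IsCompact (f ⁻¹' K))
    (α β a : ℝ)
    (h1 : ∀ x, lap f x - α * ‖∇ f x‖ ^ 2 + β * f x ≤ a)
    (h2 : ∀ x, lap f x ≤ a)
    (φ θ : ℝ → ℝ) (hθ : Continuous θ) (hθ0 : ∀ s, 0 ≤ θ s) (hθ1 : ∀ s, θ s ≤ 1)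
    (hφ0 : ∀ s, 0 ≤ φ s) (hφ : ∀ s, HasDerivAt φ (-(α * θ s * φ s)) s)
    (t : ℝ) :
    0 ≤ ∫ x, (φ (f x) * smoothTransition (t + 1 - f x)) * (a - θ (f x) * (β * f x)) := by
  have hφc : Continuous φ := continuous_iff_continuousAt.2 fun s => (hφ s).continuousAt
  have hfc := hf.continuous
  have hχ : ContDiff ℝ 1 smoothTransition := smoothTransition.contDiff (n := 1)
  have hχd : Differentiable ℝ smoothTransition := hχ.differentiable (by norm_num)
  have hχ' : Continuous (deriv smoothTransition) := hχ.continuous_deriv (by norm_num)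
  have hχc := hχ.continuous
  have hχmono : ∀ s, 0 ≤ deriv smoothTransition s := fun s => smoothTransition.monotone.deriv_nonneg
  have hχ0 : ∀ s, s ≤ 0 → deriv smoothTransition s = 0 := by
    intro s hs
    have : IsLocalMin smoothTransition s := Filter.Eventually.of_forall fun y => by
      rw [smoothTransition.zero_of_nonpos hs]; exact smoothTransition.nonneg y
    exact this.deriv_eq_zero
  let g : ℝ → ℝ := fun s => φ s * smoothTransition (t + 1 - s)
  let g' : ℝ → ℝ := fun s => -(α * θ s * φ s) * smoothTransition (t + 1 - s)
    + φ s * (-deriv smoothTransition (t + 1 - s))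
  have hg : ∀ s, HasDerivAt g (g' s) s := by
    intro s
    have hh : HasDerivAt (fun s => smoothTransition (t + 1 - s))
        (-deriv smoothTransition (t + 1 - s)) s := by
      have := (hχd (t + 1 - s)).hasDerivAt.comp s ((hasDerivAt_id s).const_sub (t + 1))
      have e : deriv smoothTransition (t + 1 - s) * -1 = -deriv smoothTransition (t + 1 - s) := by
        ring
      rw [← e]
      exact this
    exact (hφ s).mul hh
  have hgc : Continuous g := by fun_prop
  have hg'c : Continuous g' := by fun_prop
  have hR : ∀ s, t + 1 ≤ s → g s = 0 := fun s hs => by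
    simp [g, smoothTransition.zero_of_nonpos (show t + 1 - s ≤ 0 by linarith)]
  have hR' : ∀ s, t + 1 ≤ s → g' s = 0 := fun s hs => by
    simp [g', smoothTransition.zero_of_nonpos (show t + 1 - s ≤ 0 by linarith),
      hχ0 (t + 1 - s) (by linarith)]
  have := ibp f hf hf0 hproper g g' hg hg'c (t + 1) hR hR'
  rw [← this]
  apply integral_mono
  · exact (integrable_comp_mul f hfc hf0 hproper g hgc _ hR _ (continuous_lap f hf)).add
      (integrable_comp_mul f hfc hf0 hproper g' hg'c _ hR' _ (continuous_grad f hf))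
  · exact integrable_comp_mul f hfc hf0 hproper g hgc _ hR
      (fun x => a - θ (f x) * (β * f x)) (by fun_prop)
  intro x
  simp only [g, g']
  have p1 := hφ0 (f x)
  have p2 := smoothTransition.nonneg (t + 1 - f x)
  have p3 := hχmono (t + 1 - f x)
  have p4 := hθ0 (f x)
  have p5 := hθ1 (f x)
  have p6 : 0 ≤ ‖∇ f x‖ ^ 2 := by positivity
  have q1 := mul_nonneg (mul_nonneg p1 p3) p6
  have q2 := mul_nonneg (mul_nonneg p1 p2) (mul_nonneg p4 (sub_nonneg.2 (h1 x)))
  have q3 := mul_nonneg (mul_nonneg p1 p2) (mul_nonneg (sub_nonneg.2 p5) (sub_nonneg.2 (h2 x)))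
  nlinarith

lemma core2 {d : ℕ} (f : EuclideanSpace ℝ (Fin d) → ℝ)
    (hf : ContDiff ℝ 2 f) (hf0 : ∀ x, 0 ≤ f x)
    (hproper : ∀ K : Set ℝ, IsCompact K → IsCompact (f ⁻¹' K))
    (α β a : ℝ)
    (h1 : ∀ x, lap f x - α * ‖∇ f x‖ ^ 2 + β * f x ≤ a)
    (h2 : ∀ x, lap f x ≤ a)
    (φ θ : ℝ → ℝ) (hθ : Continuous θ) (hθ0 : ∀ s, 0 ≤ θ s) (hθ1 : ∀ s, θ s ≤ 1)
    (hφ0 : ∀ s, 0 ≤ φ s) (hφ : ∀ s, HasDerivAt φ (-(α * θ s * φ s)) s)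
    (T t : ℝ) (hTt : T ≤ t) (M N : ℝ) (hN : 0 ≤ N)
    (hM1 : ∀ s, 0 ≤ s → s ≤ T → φ s * (a - θ s * (β * s)) ≤ M * exp (-α * s))
    (hN1 : ∀ s, T < s → φ s * (a - θ s * (β * s)) ≤ - (N * exp (-α * s))) :
    N * ((∫ x in {x | f x ≤ t}, exp (-α * f x)) - ∫ x in {x | f x ≤ T}, exp (-α * f x))
      ≤ M * ∫ x in {x | f x ≤ T}, exp (-α * f x) := by
  have hφc : Continuous φ := continuous_iff_continuousAt.2 fun s => (hφ s).continuousAt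
  have hfc := hf.continuous
  have c := core f hf hf0 hproper α β a h1 h2 φ θ hθ hθ0 hθ1 hφ0 hφ t
  have hm : ∀ s, MeasurableSet {x | f x ≤ s} := fun s => measurableSet_le hfc.measurable measurable_const
  have hI : ∀ s, IntegrableOn (fun x => exp (-α * f x)) {x | f x ≤ s} := by
    intro s
    have hK : IsCompact {x | f x ≤ s} := by
      convert hproper (Set.Icc 0 s) isCompact_Icc using 1
      ext x; simp [hf0 x]
    exact ContinuousOn.integrableOn_compact hK (by fun_prop)
  have hIi : ∀ s, Integrable (Set.indicator {x | f x ≤ s} (fun x => exp (-α * f x))) := fun s =>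
    (integrable_indicator_iff (hm s)).2 (hI s)
  rw [← integral_indicator (hm t), ← integral_indicator (hm T)]
  have : (∫ x, (φ (f x) * smoothTransition (t + 1 - f x)) * (a - θ (f x) * (β * f x))) ≤
      ∫ x, ((M + N) * Set.indicator {x | f x ≤ T} (fun x => exp (-α * f x)) x
        - N * Set.indicator {x | f x ≤ t} (fun x => exp (-α * f x)) x) := by
    apply integral_mono
    · refine integrable_comp_mul f hfc hf0 hproper
        (fun s => φ s * smoothTransition (t + 1 - s)) ?_ (t + 1) ?_
        (fun x => a - θ (f x) * (β * f x)) (by fun_prop)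
      · exact hφc.mul (smoothTransition.continuous.comp (by fun_prop))
      · intro s hs
        simp [smoothTransition.zero_of_nonpos (show t + 1 - s ≤ 0 by linarith)]
    · exact ((hIi T).const_mul _).sub ((hIi t).const_mul _)
    intro x
    simp only [Set.indicator, Set.mem_ofPred_eq]
    rcases le_or_gt (f x) T with h | h
    · have := hM1 (f x) (hf0 x) h
      rw [if_pos h, if_pos (h.trans hTt), smoothTransition.one_of_one_le (by linarith)]
      linarith
    · have := hN1 (f x) h
      rw [if_neg (not_le.2 h)]
      have p2 := smoothTransition.nonneg (t + 1 - f x)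
      split_ifs with h'
      · rw [smoothTransition.one_of_one_le (by linarith)]
        linarith
      · have : 0 ≤ N * exp (-α * f x) := by positivity
        nlinarith
  have h3 := c.trans this
  rw [integral_sub ((hIi T).const_mul _) ((hIi t).const_mul _), integral_const_mul,
    integral_const_mul] at h3
  linarith

lemma main_real {d : ℕ} (f : EuclideanSpace ℝ (Fin d) → ℝ)
    (hf : ContDiff ℝ 2 f) (hf0 : ∀ x, 0 ≤ f x)
    (hproper : ∀ K : Set ℝ, IsCompact K → IsCompact (f ⁻¹' K))
    (α β a : ℝ) (hα : 0 < α) (hβ : 0 < β) (ha : 0 < a)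
    (h1 : ∀ x, lap f x - α * ‖∇ f x‖ ^ 2 + β * f x ≤ a)
    (h2 : ∀ x, lap f x ≤ a)
    (κ : ℝ) (hκ : a = β * κ) (T t : ℝ) (hT : 2 * κ < T) (hTt : T ≤ t) :
    (∫ x in {x | f x ≤ t}, exp (-α * f x)) - (∫ x in {x | f x ≤ T}, exp (-α * f x))
      ≤ exp (α * (κ + κ * log (T / κ) - T)) * ∫ x in {x | f x ≤ T}, exp (-α * f x) := by
  have hκ0 : 0 < κ := by
    by_contra h
    nlinarith
  have hT0 : 0 < T := by linarith
  have hq : 1 < T / κ - 1 := by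
    rw [lt_sub_iff_add_lt, lt_div_iff₀ hκ0]; linarith
  obtain ⟨η, hη0, hη1, hη2⟩ : ∃ η, 0 < η ∧ η ≤ T - κ ∧ exp (α * η) ≤ T / κ - 1 := by
    refine ⟨min (T - κ) (log (T / κ - 1) / α), lt_min (by linarith) (div_pos (log_pos hq) hα),
      min_le_left _ _, ?_⟩
    rw [← le_log_iff_exp_le (by linarith), mul_comm, ← le_div_iff₀ hα]
    exact min_le_right _ _
  let θ : ℝ → ℝ := fun s => max (κ / max s κ) (min 1 (1 - (T - s) / η))
  have hmx : ∀ s, 0 < max s κ := fun s => lt_max_of_lt_right hκ0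
  have hdl : ∀ s, κ / max s κ ≤ 1 := fun s => (div_le_one (hmx s)).2 (le_max_right _ _)
  have hθ : Continuous θ := by
    refine Continuous.max (Continuous.div continuous_const (by fun_prop) fun s => (hmx s).ne') ?_
    fun_prop
  have hθ0 : ∀ s, 0 ≤ θ s := fun s => le_max_of_le_left (div_nonneg hκ0.le (hmx s).le)
  have hθ1 : ∀ s, θ s ≤ 1 := fun s => max_le (hdl s) (min_le_left _ _)
  have hθlow : ∀ s, s ≤ κ → θ s = 1 := by
    intro s hs
    refine le_antisymm (hθ1 s) (le_max_of_le_left ?_)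
    rw [max_eq_right hs, div_self hκ0.ne']
  have hθhigh : ∀ s, T ≤ s → θ s = 1 := by
    intro s hs
    refine le_antisymm (hθ1 s) (le_max_of_le_right (le_min le_rfl ?_))
    have : (T - s) / η ≤ 0 := div_nonpos_of_nonpos_of_nonneg (by linarith) hη0.le
    linarith
  have hθmid : ∀ s, κ ≤ s → s ≤ T - η → θ s = κ * s⁻¹ := by
    intro s hs hs'
    have h3 : 1 ≤ (T - s) / η := by rw [le_div_iff₀ hη0]; linarith
    have h4 : min 1 (1 - (T - s) / η) ≤ κ / max s κ :=
      (min_le_right _ _).trans ((by linarith : 1 - (T - s) / η ≤ 0).trans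
        (div_nonneg hκ0.le (hmx s).le))
    simp only [θ]
    rw [max_eq_left h4, max_eq_left hs, div_eq_mul_inv]
  let I : ℝ → ℝ := fun s => ∫ x in (0 : ℝ)..s, θ x
  have hint : ∀ p q, IntervalIntegrable θ volume p q := fun p q => hθ.intervalIntegrable p q
  have hI : ∀ s, HasDerivAt I (θ s) s := fun s =>
    (hθ.integral_hasStrictDerivAt 0 s).hasDerivAt
  have hIlow : ∀ s, 0 ≤ s → s ≤ κ → I s = s := by
    intro s hs hs'
    have : I s = ∫ x in (0 : ℝ)..s, (1 : ℝ) := by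
      apply intervalIntegral.integral_congr
      intro x hx
      rw [Set.uIcc_of_le hs] at hx
      exact hθlow x (hx.2.trans hs')
    rw [this]; simp
  have hIhigh : ∀ s, T ≤ s → I s = I T + (s - T) := by
    intro s hs
    have e : ∫ x in T..s, θ x = ∫ x in T..s, (1 : ℝ) := by
      apply intervalIntegral.integral_congr
      intro x hx
      rw [Set.uIcc_of_le hs] at hx
      exact hθhigh x hx.1
    have := intervalIntegral.integral_add_adjacent_intervals (hint 0 T) (hint T s)
    rw [e] at this
    simp only [I]
    rw [← this]; simp
  have hIT : I T ≤ κ + κ * log (T / κ) + η := by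
    have e1 : ∫ x in κ..(T - η), θ x = κ * log ((T - η) / κ) := by
      rw [← integral_inv_of_pos hκ0 (by linarith), ← intervalIntegral.integral_const_mul]
      apply intervalIntegral.integral_congr
      intro x hx
      rw [Set.uIcc_of_le (by linarith)] at hx
      exact hθmid x hx.1 hx.2
    have e2 : ∫ x in (T - η)..T, θ x ≤ η := by
      have : ∫ x in (T - η)..T, θ x ≤ ∫ x in (T - η)..T, (1 : ℝ) :=
        intervalIntegral.integral_mono_on (by linarith) (hint _ _) (by simp) fun x _ => hθ1 x
      simpa using this
    have e3 : I κ = κ := hIlow κ hκ0.le le_rfl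
    have a1 := intervalIntegral.integral_add_adjacent_intervals (hint 0 κ) (hint κ (T - η))
    have a2 := intervalIntegral.integral_add_adjacent_intervals (hint 0 (T - η)) (hint (T - η) T)
    have e4 : log ((T - η) / κ) ≤ log (T / κ) :=
      log_le_log (div_pos (by linarith) hκ0) (by gcongr; linarith)
    have e5 : κ * log ((T - η) / κ) ≤ κ * log (T / κ) := by gcongr
    simp only [I] at e3 ⊢
    linarith
  let φ : ℝ → ℝ := fun s => exp (-α * I s)
  have hφ : ∀ s, HasDerivAt φ (-(α * θ s * φ s)) s := by
    intro s
    have := ((hI s).const_mul (-α)).exp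
    convert this using 1
    simp only [φ]; ring
  set N := exp (-α * (I T - T)) * (β * T - a) with hN
  have hbT : 0 < β * T - a := by rw [hκ]; nlinarith
  have hN0 : 0 < N := by positivity
  have c := core2 f hf hf0 hproper α β a h1 h2 φ θ hθ hθ0 hθ1 (fun s => (exp_pos _).le) hφ T t hTt
    a N hN0.le ?_ ?_
  · set W := ∫ x in {x | f x ≤ t}, exp (-α * f x)
    have hW' : 0 ≤ ∫ x in {x | f x ≤ T}, exp (-α * f x) := integral_nonneg fun x => (exp_pos _).le
    set W' := ∫ x in {x | f x ≤ T}, exp (-α * f x)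
    set E := exp (α * (κ + κ * log (T / κ) - T)) with hE
    have hEN : a ≤ N * E := by
      have e : N * E = exp (α * (κ + κ * log (T / κ) - I T)) * (β * T - a) := by
        rw [hN, hE, mul_right_comm, ← exp_add]; ring_nf
      have e2 : exp (-(α * η)) ≤ exp (α * (κ + κ * log (T / κ) - I T)) := by
        apply exp_le_exp.2; nlinarith
      have e3 : a * exp (α * η) ≤ β * T - a := by
        calc a * exp (α * η) ≤ a * (T / κ - 1) := by gcongr
          _ = β * T - a := by rw [hκ]; field_simp
      rw [e]
      calc a = exp (-(α * η)) * (a * exp (α * η)) := by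
            rw [mul_left_comm, ← exp_add]; simp
        _ ≤ _ := by gcongr
    have : N * (W - W') ≤ N * (E * W') := c.trans (by nlinarith)
    exact le_of_mul_le_mul_left this hN0
  · intro s hs _
    rcases le_or_gt s κ with h | h
    · simp only [φ]
      rw [hθlow s h, hIlow s hs h]
      have := exp_pos (-α * s)
      nlinarith [mul_nonneg hβ.le hs]
    · have h5 : κ ≤ θ s * s := by
        have : κ / s ≤ θ s := by
          have : κ / max s κ ≤ θ s := le_max_left _ _
          rwa [max_eq_left h.le] at this
        rwa [div_le_iff₀ (hκ0.trans h)] at this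
      have h6 : a - θ s * (β * s) ≤ 0 := by rw [hκ]; nlinarith
      have h7 : φ s * (a - θ s * (β * s)) ≤ 0 :=
        mul_nonpos_of_nonneg_of_nonpos (exp_pos _).le h6
      exact h7.trans (by positivity)
  · intro s hs
    have e : φ s = exp (-α * (I T - T)) * exp (-α * s) := by
      simp only [φ]
      rw [hIhigh s hs.le, ← exp_add]; ring_nf
    rw [e, hθhigh s hs.le, hN]
    have : 0 < exp (-α * (I T - T)) * exp (-α * s) := by positivity
    nlinarith [mul_pos this (mul_pos hβ (sub_pos.2 hs))]

lemma main_neg {d : ℕ} (f : EuclideanSpace ℝ (Fin d) → ℝ)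
    (hf : ContDiff ℝ 2 f) (hf0 : ∀ x, 0 ≤ f x)
    (hproper : ∀ K : Set ℝ, IsCompact K → IsCompact (f ⁻¹' K))
    (α β a : ℝ) (hβ : 0 < β) (ha : a ≤ 0)
    (h1 : ∀ x, lap f x - α * ‖∇ f x‖ ^ 2 + β * f x ≤ a)
    (h2 : ∀ x, lap f x ≤ a)
    (T t : ℝ) (hT : 0 < T) (hTt : T ≤ t) :
    (∫ x in {x | f x ≤ t}, exp (-α * f x)) - (∫ x in {x | f x ≤ T}, exp (-α * f x)) ≤ 0 := by
  have c := core2 f hf hf0 hproper α β a h1 h2 (fun s => exp (-α * s)) (fun _ => 1)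
    continuous_const (by simp) (by simp) (fun s => (exp_pos _).le) ?_ T t hTt 0 (β * T)
    (by positivity) ?_ ?_
  · rw [zero_mul] at c
    have : 0 < β * T := by positivity
    by_contra h
    push Not at h
    nlinarith [mul_pos this h]
  · intro s
    have := ((hasDerivAt_id s).const_mul (-α)).exp
    have e : -(α * 1 * exp (-α * s)) = exp (-α * s) * (-α * 1) := by ring
    rw [e]
    exact this
  · intro s hs _
    have : 0 < exp (-α * s) := exp_pos _
    nlinarith [mul_nonneg hβ.le hs]
  · intro s hs
    have : 0 < exp (-α * s) := exp_pos _
    nlinarith [mul_pos this (mul_pos hβ (sub_pos.2 hs))]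

lemma arith (τ κ r : ℝ) (hτ : 0 < τ) (hκ : 0 < κ) (hr : 1 ≤ r)
    (h : τ + 2 * κ * log r < τ * (r - 1) ^ 2) :
    2 * κ < τ * (r - 1) ^ 2 ∧
      κ + κ * log (τ * (r - 1) ^ 2 / κ) ≤ τ + 2 * κ * log r := by
  have hl : 0 ≤ log r := log_nonneg hr
  have h2 : 1 < (r - 1) ^ 2 := by
    by_contra h'
    push Not at h'
    nlinarith [mul_nonneg hκ.le hl]
  have hr2 : 2 < r := by nlinarith
  constructor
  · rcases le_or_gt 1 (log r) with h3 | h3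
    · nlinarith
    · have hre : r < 2.7182818286 := by
        have : r < exp 1 := by rwa [← log_lt_iff_lt_exp (by linarith)]
        exact this.trans exp_one_lt_d9
      have hl2 : 0.69 < log r := by
        have := log_lt_log (by norm_num) hr2
        linarith [log_two_gt_d9]
      set q := (r - 1) ^ 2 with hq
      have hq3 : q < 3 := by nlinarith
      by_contra h4
      push Not at h4
      -- τ q ≤ 2κ, τ (q - 1) > 1.38 κ
      have h5 : 1.38 * κ < τ * (q - 1) := by nlinarith
      nlinarith
  · have e1 : log (τ * (r - 1) ^ 2 / κ) ≤ log (τ / κ * r ^ 2) := by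
      apply log_le_log (by positivity)
      rw [mul_div_right_comm]
      gcongr <;> linarith
    rw [log_mul (by positivity) (by positivity), log_pow] at e1
    have e2 : log (τ / κ) ≤ τ / κ - 1 := log_le_sub_one_of_pos (by positivity)
    have e3 : κ * log (τ * (r - 1) ^ 2 / κ) ≤ κ * (τ / κ - 1 + 2 * log r) := by
      gcongr
      push_cast at e1
      linarith
    have e4 : κ * (τ / κ - 1 + 2 * log r) = τ - κ + 2 * κ * log r := by field_simp
    linarith

theorem annulus_estimate {d : ℕ} (f : EuclideanSpace ℝ (Fin d) → ℝ)
    (hf : ContDiff ℝ 2 f) (hf0 : ∀ x, 0 ≤ f x)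
    (hproper : ∀ K : Set ℝ, IsCompact K → IsCompact (f ⁻¹' K))
    (α β a : ℝ) (hα : 0 < α) (hβ : 0 < β)
    (h1 : ∀ x, lap f x - α * ‖∇ f x‖ ^ 2 + β * f x ≤ a)
    (h2 : ∀ x, lap f x ≤ a)
    (r : ℝ) (hr : 1 ≤ r) :
    (∫⁻ x in {x : EuclideanSpace ℝ (Fin d) | 2 * Real.sqrt (f x) ≤ Real.sqrt (2 * β) * r},
          ENNReal.ofReal (Real.exp (-α * f x))) -
        (∫⁻ x in {x : EuclideanSpace ℝ (Fin d) |
              2 * Real.sqrt (f x) ≤ Real.sqrt (2 * β) * (r - 1)},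
            ENNReal.ofReal (Real.exp (-α * f x))) ≤
      ENNReal.ofReal
          (Real.exp (α * β / 2) * r ^ (2 * α * a / β) *
            Real.exp (-(α * β * (r - 1) ^ 2 / 2))) *
        ∫⁻ x in {x : EuclideanSpace ℝ (Fin d) | 2 * Real.sqrt (f x) ≤ Real.sqrt (2 * β) * r},
          ENNReal.ofReal (Real.exp (-α * f x)) := by
  have hset : ∀ s : ℝ, 0 ≤ s →
      {x : EuclideanSpace ℝ (Fin d) | 2 * Real.sqrt (f x) ≤ Real.sqrt (2 * β) * s} =
      {x | f x ≤ β / 2 * s ^ 2} := by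
    intro s hs
    ext x
    simp only [Set.mem_ofPred_eq]
    have p1 := Real.sqrt_nonneg (f x)
    have p2 := Real.sq_sqrt (hf0 x)
    have p3 := Real.sqrt_nonneg (2 * β)
    have p4 := Real.sq_sqrt (show 0 ≤ 2 * β by positivity)
    rw [← pow_le_pow_iff_left₀ (by positivity) (by positivity) two_ne_zero, mul_pow, mul_pow,
      p2, p4]
    constructor <;> intro h <;> linarith
  rw [hset r (by linarith), hset (r - 1) (by linarith)]
  set C := Real.exp (α * β / 2) * r ^ (2 * α * a / β) *
            Real.exp (-(α * β * (r - 1) ^ 2 / 2)) with hC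
  rcases le_or_gt 1 C with h | hC1
  · refine tsub_le_self.trans ?_
    conv_lhs => rw [← one_mul (∫⁻ x in {x | f x ≤ β / 2 * r ^ 2}, _)]
    gcongr
    rw [← ENNReal.ofReal_one]
    exact ENNReal.ofReal_le_ofReal h
  have hr0 : 0 < r := by linarith
  have hCe : C = exp (α * (β / 2 + 2 * (a / β) * log r - β / 2 * (r - 1) ^ 2)) := by
    rw [hC, rpow_def_of_pos hr0, ← exp_add, ← exp_add]
    congr 1
    field_simp
    ring
  have hlt : β / 2 + 2 * (a / β) * log r < β / 2 * (r - 1) ^ 2 := by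
    rw [hCe, exp_lt_one_iff] at hC1
    by_contra h'
    push Not at h'
    nlinarith [mul_nonneg hα.le (sub_nonneg.2 h')]
  have hr1 : 1 < r := by
    rcases hr.eq_or_lt with h | h
    · subst h
      simp at hlt
      linarith
    · exact h
  have hI : ∀ s, Integrable (fun x => exp (-α * f x)) (volume.restrict {x | f x ≤ s}) := by
    intro s
    have hfc := hf.continuous
    have hK : IsCompact {x | f x ≤ s} := by
      convert hproper (Set.Icc 0 s) isCompact_Icc using 1
      ext x; simp [hf0 x]
    exact ContinuousOn.integrableOn_compact hK (by fun_prop)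
  have hTt : β / 2 * (r - 1) ^ 2 ≤ β / 2 * r ^ 2 := by
    gcongr <;> linarith
  have hT0 : 0 < β / 2 * (r - 1) ^ 2 := by
    have : 0 < r - 1 := by linarith
    positivity
  have hnn : ∀ s, 0 ≤ ∫ x in {x | f x ≤ s}, exp (-α * f x) := fun s =>
    integral_nonneg fun x => (exp_pos _).le
  rw [← ofReal_integral_eq_lintegral_ofReal (hI _) (Filter.Eventually.of_forall fun x => (exp_pos _).le),
    ← ofReal_integral_eq_lintegral_ofReal (hI _) (Filter.Eventually.of_forall fun x => (exp_pos _).le),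
    ← ENNReal.ofReal_sub _ (hnn _), ← ENNReal.ofReal_mul (by positivity)]
  apply ENNReal.ofReal_le_ofReal
  rcases le_or_gt a 0 with ha | ha
  · exact (main_neg f hf hf0 hproper α β a hβ ha h1 h2 _ _ hT0 hTt).trans
      (mul_nonneg (by positivity) (hnn _))
  · have hκ : 0 < a / β := by positivity
    obtain ⟨A1, A2⟩ := arith (β / 2) (a / β) r (by positivity) hκ hr hlt
    refine (main_real f hf hf0 hproper α β a hα hβ ha h1 h2 (a / β) (by field_simp) _ _ A1
      hTt).trans ?_
    have m : (∫ x in {x | f x ≤ β / 2 * (r - 1) ^ 2}, exp (-α * f x)) ≤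
        ∫ x in {x | f x ≤ β / 2 * r ^ 2}, exp (-α * f x) :=
      setIntegral_mono_set (hI _) (Filter.Eventually.of_forall fun x => (exp_pos _).le)
        (Filter.Eventually.of_forall fun x hx => le_trans hx hTt)
    refine mul_le_mul ?_ m (hnn _) (by positivity)
    rw [hCe]
    apply exp_le_exp.2
    gcongr
end
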